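/- Let C be a category of two-colored partitions containing the crossing partition X (the group case), and let C₀ := C ∩ NC°•. Then C = ⟨C₀, X⟩, the smallest category containing C₀ and X. -/

import Mathlib

noncomputable section
namespace CTCP

/-- Colors of points: `true` = white (∘), `false` = black (•). -/
abbrev Color := Bool

def white : Color := true
def black : Color := false

/-- A two-colored partition with `k` upper and `l` lower points.  The block
structure is recorded as a setoid on the disjoint union of the points. -/
structure TCP where
  k : ℕ
  l : ℕ
  upColor : Fin k → Color
  lowColor : Fin l → Color
  rel : Setoid (Fin k ⊕ Fin l)

/-- The disjoint union of two equivalence relations. -/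
def sumRel {α β : Type*} (r : Setoid α) (s : Setoid β) : (α ⊕ β) → (α ⊕ β) → Prop
  | .inl a, .inl b => r.r a b
  | .inr a, .inr b => s.r a b
  | _, _ => False

def sumSetoid {α β : Type*} (r : Setoid α) (s : Setoid β) : Setoid (α ⊕ β) where
  r := sumRel r s
  iseqv := by
    constructor
    · rintro (a | a)
      · exact r.iseqv.refl a
      · exact s.iseqv.refl a
    · rintro (a | a) (b | b) h
      · exact r.iseqv.symm h
      · exact h.elim
      · exact h.elim
      · exact s.iseqv.symm h
    · rintro (a | a) (b | b) (c | c) h₁ h₂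
      all_goals first
        | exact r.iseqv.trans h₁ h₂
        | exact s.iseqv.trans h₁ h₂
        | exact h₁.elim
        | exact h₂.elim

def splitPt (p q : TCP) :
    (Fin (p.k + q.k) ⊕ Fin (p.l + q.l)) → ((Fin p.k ⊕ Fin p.l) ⊕ (Fin q.k ⊕ Fin q.l))
  | .inl i => (finSumFinEquiv.symm i).elim (fun a => .inl (.inl a)) (fun b => .inr (.inl b))
  | .inr j => (finSumFinEquiv.symm j).elim (fun a => .inl (.inr a)) (fun b => .inr (.inr b))

/-- Tensor product (horizontal concatenation) of two-colored partitions. -/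
def tensor (p q : TCP) : TCP where
  k := p.k + q.k
  l := p.l + q.l
  upColor := fun i => (finSumFinEquiv.symm i).elim p.upColor q.upColor
  lowColor := fun j => (finSumFinEquiv.symm j).elim p.lowColor q.lowColor
  rel := Setoid.comap (splitPt p q) (sumSetoid p.rel q.rel)

def compEmbMid (q p : TCP) (h : q.l = p.k) :
    (Fin p.k ⊕ Fin p.l) → ((Fin q.k ⊕ Fin q.l) ⊕ Fin p.l)
  | .inl i => .inl (.inr (Fin.cast h.symm i))
  | .inr j => .inr j

/-- The relation generating the blocks of the composition of `q` and `p`: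
the blocks of `q` together with the blocks of `p`, glued along the middle row. -/
def compRel (q p : TCP) (h : q.l = p.k) :
    ((Fin q.k ⊕ Fin q.l) ⊕ Fin p.l) → ((Fin q.k ⊕ Fin q.l) ⊕ Fin p.l) → Prop :=
  fun t t' =>
    (∃ x y, q.rel.r x y ∧ t = .inl x ∧ t' = .inl y) ∨
    (∃ x y, p.rel.r x y ∧ t = compEmbMid q p h x ∧ t' = compEmbMid q p h y)

/-- Composition (vertical concatenation) of `q ∈ P(k,l)` with `p ∈ P(l,m)`:
blocks are joined through the middle points, which are then deleted. -/
def comp (q p : TCP) (h : q.l = p.k) : TCP where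
  k := q.k
  l := p.l
  upColor := q.upColor
  lowColor := p.lowColor
  rel := Setoid.comap
    (Sum.elim (fun i : Fin q.k => (Sum.inl (Sum.inl i) : (Fin q.k ⊕ Fin q.l) ⊕ Fin p.l))
      (fun j : Fin p.l => Sum.inr j))
    (Relation.EqvGen.setoid (compRel q p h))

/-- The colors of the lower row of `q` match the colors of the upper row of `p`. -/
def ColorsMatch (q p : TCP) (h : q.l = p.k) : Prop :=
  ∀ j : Fin q.l, q.lowColor j = p.upColor (Fin.cast h j)

/-- Involution: reflection at the horizontal axis. -/
def invol (p : TCP) : TCP where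
  k := p.l
  l := p.k
  upColor := p.lowColor
  lowColor := p.upColor
  rel := Setoid.comap Sum.swap p.rel

/-- Vertical reflection: reflection at the vertical axis. -/
def vref (p : TCP) : TCP where
  k := p.k
  l := p.l
  upColor := fun i => p.upColor i.rev
  lowColor := fun j => p.lowColor j.rev
  rel := Setoid.comap (Sum.map Fin.rev Fin.rev) p.rel

/-- Inversion of colors. -/
def cinv (p : TCP) : TCP where
  k := p.k
  l := p.l
  upColor := fun i => !(p.upColor i)
  lowColor := fun j => !(p.lowColor j)
  rel := p.rel

/-- Verticolor reflection `p̃`: vertical reflection combined with color inversion. -/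
def vcref (p : TCP) : TCP := cinv (vref p)

/-- Rotation of the leftmost upper point to the left end of the lower row
(inverting its color). -/
def rotULdown (p : TCP) (h : 0 < p.k) : TCP where
  k := p.k - 1
  l := p.l + 1
  upColor := fun i => p.upColor ⟨i.1 + 1, by have := i.2; omega⟩
  lowColor := fun j =>
    if hj : j.1 = 0 then !(p.upColor ⟨0, h⟩)
    else p.lowColor ⟨j.1 - 1, by have := j.2; omega⟩
  rel := Setoid.comap
    (Sum.elim
      (fun i : Fin (p.k - 1) => (Sum.inl ⟨i.1 + 1, by have := i.2; omega⟩ : Fin p.k ⊕ Fin p.l))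
      (fun j : Fin (p.l + 1) =>
        if hj : j.1 = 0 then Sum.inl ⟨0, h⟩
        else Sum.inr ⟨j.1 - 1, by have := j.2; omega⟩))
    p.rel

/-- Rotation of the rightmost upper point to the right end of the lower row
(inverting its color). -/
def rotURdown (p : TCP) (h : 0 < p.k) : TCP where
  k := p.k - 1
  l := p.l + 1
  upColor := fun i => p.upColor ⟨i.1, by have := i.2; omega⟩
  lowColor := fun j =>
    if hj : j.1 < p.l then p.lowColor ⟨j.1, hj⟩
    else !(p.upColor ⟨p.k - 1, by omega⟩)
  rel := Setoid.comap
    (Sum.elim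
      (fun i : Fin (p.k - 1) => (Sum.inl ⟨i.1, by have := i.2; omega⟩ : Fin p.k ⊕ Fin p.l))
      (fun j : Fin (p.l + 1) =>
        if hj : j.1 < p.l then Sum.inr ⟨j.1, hj⟩
        else Sum.inl ⟨p.k - 1, by omega⟩))
    p.rel

/-- Rotation of the leftmost lower point to the left end of the upper row
(inverting its color). -/
def rotULup (p : TCP) (h : 0 < p.l) : TCP where
  k := p.k + 1
  l := p.l - 1
  upColor := fun i =>
    if hi : i.1 = 0 then !(p.lowColor ⟨0, h⟩)
    else p.upColor ⟨i.1 - 1, by have := i.2; omega⟩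
  lowColor := fun j => p.lowColor ⟨j.1 + 1, by have := j.2; omega⟩
  rel := Setoid.comap
    (Sum.elim
      (fun i : Fin (p.k + 1) =>
        if hi : i.1 = 0 then (Sum.inr ⟨0, h⟩ : Fin p.k ⊕ Fin p.l)
        else Sum.inl ⟨i.1 - 1, by have := i.2; omega⟩)
      (fun j : Fin (p.l - 1) => Sum.inr ⟨j.1 + 1, by have := j.2; omega⟩))
    p.rel

/-- Rotation of the rightmost lower point to the right end of the upper row
(inverting its color). -/
def rotURup (p : TCP) (h : 0 < p.l) : TCP where
  k := p.k + 1
  l := p.l - 1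
  upColor := fun i =>
    if hi : i.1 < p.k then p.upColor ⟨i.1, hi⟩
    else !(p.lowColor ⟨p.l - 1, by omega⟩)
  lowColor := fun j => p.lowColor ⟨j.1, by have := j.2; omega⟩
  rel := Setoid.comap
    (Sum.elim
      (fun i : Fin (p.k + 1) =>
        if hi : i.1 < p.k then (Sum.inl ⟨i.1, hi⟩ : Fin p.k ⊕ Fin p.l)
        else Sum.inr ⟨p.l - 1, by omega⟩)
      (fun j : Fin (p.l - 1) => Sum.inr ⟨j.1, by have := j.2; omega⟩))
    p.rel

/-- `p'` is obtained from `p` by rotating an outermost point of one row to the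
corresponding end of the other row, inverting its color. -/
def IsRotationOf (p' p : TCP) : Prop :=
  (∃ h : 0 < p.k, p' = rotULdown p h) ∨ (∃ h : 0 < p.k, p' = rotURdown p h) ∨
  (∃ h : 0 < p.l, p' = rotULup p h) ∨ (∃ h : 0 < p.l, p' = rotURup p h)

/-- A partition with no upper points, given by colors and block labels. -/
def mkLower (n : ℕ) (color : Fin n → Color) (lbl : Fin n → ℕ) : TCP where
  k := 0
  l := n
  upColor := Fin.elim0
  lowColor := color
  rel := Setoid.ker (Sum.elim Fin.elim0 lbl)

/-- The identity partition of color `c`. -/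
def idPart (c : Color) : TCP where
  k := 1
  l := 1
  upColor := fun _ => c
  lowColor := fun _ => c
  rel := ⊤

/-- The pair partition on two lower points of colors `c₁`, `c₂`. -/
def pairLower (c₁ c₂ : Color) : TCP := mkLower 2 ![c₁, c₂] (fun _ => 0)

/-- The singleton of color `c`. -/
def singl (c : Color) : TCP := mkLower 1 (fun _ => c) (fun _ => 0)

/-- `bPart s` : one block on `s` white lower points (`bPart 0` is the empty partition). -/
def bPart (s : ℕ) : TCP := mkLower s (fun _ => white) (fun _ => 0)

/-- One block on four lower points with the given colors. -/
def fourBlock (c₁ c₂ c₃ c₄ : Color) : TCP := mkLower 4 ![c₁, c₂, c₃, c₄] (fun _ => 0)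

/-- The four-block ∘•∘•. -/
def fourWBWB : TCP := fourBlock white black white black

/-- The four-block ∘∘••. -/
def fourWWBB : TCP := fourBlock white white black black

/-- The empty partition. -/
def emptyPart : TCP := mkLower 0 Fin.elim0 Fin.elim0

/-- The partition ∘⊗• (a white and a black singleton). -/
def singPair : TCP := tensor (singl white) (singl black)

/-- The partition ∘∘⊗••. -/
def wwbb : TCP := tensor (pairLower white white) (pairLower black black)

/-- The crossing partition `X` on four white points: first upper point connected to the
second lower point, second upper point connected to the first lower point. -/
def crossPart : TCP where
  k := 2
  l := 2
  upColor := fun _ => white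
  lowColor := fun _ => white
  rel := Setoid.ker (Sum.elim (fun i : Fin 2 => (i.1 : ℕ)) (fun j : Fin 2 => 1 - j.1))

/-- `n`-fold tensor power. -/
def tensorPow (p : TCP) : ℕ → TCP
  | 0 => emptyPart
  | n + 1 => tensor (tensorPow p n) p

/-- The partition `p_d`: from left to right, `d` white singletons, a white point, `d` black
singletons and a black point, the two non-singleton points forming a pair block. -/
def pPart (d : ℕ) : TCP :=
  mkLower (2 * d + 2) (fun j => decide (j.1 ≤ d))
    (fun j => if j.1 = d ∨ j.1 = 2 * d + 1 then 0 else j.1 + 1)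

/-- The partition `p′_r`: from left to right, `r+1` white singletons, a black point, `r−1`
black singletons and a black point, the black non-singleton points forming a pair block;
for `r = 0` the middle consists of one white singleton instead. -/
def pPrime (r : ℕ) : TCP :=
  if r = 0 then
    mkLower 4 ![white, black, white, black]
      (fun j => if j.1 = 1 ∨ j.1 = 3 then 0 else j.1 + 1)
  else
    mkLower (2 * r + 2) (fun j => decide (j.1 ≤ r))
      (fun j => if j.1 = r + 1 ∨ j.1 = 2 * r + 1 then 0 else j.1 + 1)

/-- A category of two-colored partitions: a class of two-colored partitions closed under
tensor products, composition (when defined) and involution, containing both bicolored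
pair partitions and both identity partitions. -/
structure IsCategory (C : Set TCP) : Prop where
  tensor_mem : ∀ p ∈ C, ∀ q ∈ C, tensor p q ∈ C
  comp_mem : ∀ q ∈ C, ∀ p ∈ C, ∀ h : q.l = p.k, ColorsMatch q p h → comp q p h ∈ C
  invol_mem : ∀ p ∈ C, invol p ∈ C
  idw_mem : idPart white ∈ C
  idb_mem : idPart black ∈ C
  pairwb_mem : pairLower white black ∈ C
  pairbw_mem : pairLower black white ∈ C

/-- The smallest category of partitions containing `S`. -/
def generated (S : Set TCP) : Set TCP :=
  {p | ∀ C : Set TCP, IsCategory C → S ⊆ C → p ∈ C}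

/-- `c(p)` : (white lower points + black upper points) − (black lower points + white upper
points). -/
def cval (p : TCP) : ℤ :=
  ((Nat.card {j : Fin p.l // p.lowColor j = white} +
      Nat.card {i : Fin p.k // p.upColor i = black} : ℕ) : ℤ) -
    ((Nat.card {j : Fin p.l // p.lowColor j = black} +
      Nat.card {i : Fin p.k // p.upColor i = white} : ℕ) : ℤ)

/-- Position of a point on the line obtained by rotating all upper points down to the
left of the lower row. -/
def linePos (p : TCP) : (Fin p.k ⊕ Fin p.l) → ℕ :=
  Sum.elim (fun i => p.k - 1 - i.1) (fun j => p.k + j.1)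

/-- A partition is noncrossing if its strings can be drawn without crossings. -/
def Noncrossing (p : TCP) : Prop :=
  ∀ a b x y : Fin p.k ⊕ Fin p.l,
    linePos p a < linePos p b → linePos p b < linePos p x → linePos p x < linePos p y →
    p.rel.r a x → p.rel.r b y → p.rel.r a b

/-- The number of points in the block of the point `x`. -/
def blockSize (p : TCP) (x : Fin p.k ⊕ Fin p.l) : ℕ := Nat.card {y // p.rel.r x y}

/-- The partition obtained from `p` by rotating all upper points down, so that it has no
upper points. -/
def toLine (p : TCP) : TCP where
  k := 0
  l := p.k + p.l
  upColor := Fin.elim0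
  lowColor := fun j =>
    if hj : j.1 < p.k then !(p.upColor ⟨p.k - 1 - j.1, by omega⟩)
    else p.lowColor ⟨j.1 - p.k, by have := j.2; omega⟩
  rel := Setoid.comap
    (Sum.elim (fun i : Fin 0 => (Fin.elim0 i : Fin p.k ⊕ Fin p.l))
      (fun j : Fin (p.k + p.l) =>
        if hj : j.1 < p.k then Sum.inl ⟨p.k - 1 - j.1, by omega⟩
        else Sum.inr ⟨j.1 - p.k, by have := j.2; omega⟩))
    p.rel

def eraseLowRel (p : TCP) (j : ℕ) (hj : j + 1 < p.l) :
    (Fin p.k ⊕ Fin p.l) → (Fin p.k ⊕ Fin p.l) → Prop :=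
  fun x y => p.rel.r x y ∨ (x = Sum.inr ⟨j, by omega⟩ ∧ y = Sum.inr ⟨j + 1, hj⟩)

/-- Erasing the `j`-th and `(j+1)`-th lower points of `p`, first joining their blocks. -/
def eraseLowerPair (p : TCP) (j : ℕ) (hj : j + 1 < p.l) : TCP where
  k := p.k
  l := p.l - 2
  upColor := p.upColor
  lowColor := fun m =>
    if hm : m.1 < j then p.lowColor ⟨m.1, by omega⟩
    else p.lowColor ⟨m.1 + 2, by have := m.2; omega⟩
  rel := Setoid.comap
    (Sum.elim (fun i : Fin p.k => (Sum.inl i : Fin p.k ⊕ Fin p.l))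
      (fun m : Fin (p.l - 2) =>
        if hm : m.1 < j then Sum.inr ⟨m.1, by omega⟩
        else Sum.inr ⟨m.1 + 2, by have := m.2; omega⟩))
    (Relation.EqvGen.setoid (eraseLowRel p j hj))

def eraseUpRel (p : TCP) (j : ℕ) (hj : j + 1 < p.k) :
    (Fin p.k ⊕ Fin p.l) → (Fin p.k ⊕ Fin p.l) → Prop :=
  fun x y => p.rel.r x y ∨ (x = Sum.inl ⟨j, by omega⟩ ∧ y = Sum.inl ⟨j + 1, hj⟩)

/-- Erasing the `j`-th and `(j+1)`-th upper points of `p`, first joining their blocks. -/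
def eraseUpperPair (p : TCP) (j : ℕ) (hj : j + 1 < p.k) : TCP where
  k := p.k - 2
  l := p.l
  upColor := fun m =>
    if hm : m.1 < j then p.upColor ⟨m.1, by omega⟩
    else p.upColor ⟨m.1 + 2, by have := m.2; omega⟩
  lowColor := p.lowColor
  rel := Setoid.comap
    (Sum.elim
      (fun m : Fin (p.k - 2) =>
        if hm : m.1 < j then (Sum.inl ⟨m.1, by omega⟩ : Fin p.k ⊕ Fin p.l)
        else Sum.inl ⟨m.1 + 2, by have := m.2; omega⟩)
      (fun i : Fin p.l => Sum.inr i))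
    (Relation.EqvGen.setoid (eraseUpRel p j hj))

/-- `p₁ ⊗ p₂ ∈ C` is in nest decomposed form, with the first point of `p₂` colored `x`
and the last point of `p₂` colored `y` (and those two points in the same block). -/
def InNDF (C : Set TCP) (x y : Color) (p₁ p₂ : TCP) : Prop :=
  tensor p₁ p₂ ∈ C ∧ Noncrossing (tensor p₁ p₂) ∧ p₁.k = 0 ∧ p₂.k = 0 ∧ 0 < p₁.l ∧
    ∃ h : 2 ≤ p₂.l,
      p₂.lowColor ⟨0, by omega⟩ = x ∧ p₂.lowColor ⟨p₂.l - 1, by omega⟩ = y ∧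
      p₂.rel.r (Sum.inr ⟨0, by omega⟩) (Sum.inr ⟨p₂.l - 1, by omega⟩)

/-- `K^C(x,y)`: the set of values `c(p₁)` over nest decomposed forms `p₁ ⊗ p₂ ∈ C` whose
outer block starts with color `x` and ends with color `y`. -/
def Kset (C : Set TCP) (x y : Color) : Set ℤ :=
  {n | ∃ p₁ p₂, InNDF C x y p₁ p₂ ∧ cval p₁ = n}

/-- The degree of reflection `k(C)`. -/
def kdeg (C : Set TCP) : ℕ := sInf {n : ℕ | 0 < n ∧ ∃ p ∈ C, cval p = (n : ℤ)}

/-- The local parameter `d(C)`. -/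
def ddeg (C : Set TCP) : ℕ := sInf {n : ℕ | 0 < n ∧ (n : ℤ) ∈ Kset C white black}

/-- The local parameter `r(C) = min {t ≥ 1 | t ∈ K^C(•,•)} − 1`. -/
def rdeg (C : Set TCP) : ℕ := sInf {t : ℕ | 1 ≤ t ∧ (t : ℤ) ∈ Kset C black black} - 1

/-- `C` is globally colorized if it contains `∘∘ ⊗ ••`. -/
def GloballyColorized (C : Set TCP) : Prop := wwbb ∈ C

def CaseO (C : Set TCP) : Prop := singPair ∉ C ∧ fourWBWB ∉ C
def CaseB (C : Set TCP) : Prop := singPair ∈ C ∧ fourWBWB ∉ C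
def CaseH (C : Set TCP) : Prop := singPair ∉ C ∧ fourWBWB ∈ C
def CaseS (C : Set TCP) : Prop := singPair ∈ C ∧ fourWBWB ∈ C

/-! Non-colored partitions. -/

/-- A non-colored partition with `k` upper and `l` lower points. -/
structure NCP where
  k : ℕ
  l : ℕ
  rel : Setoid (Fin k ⊕ Fin l)

namespace NCP

def splitPt (p q : NCP) :
    (Fin (p.k + q.k) ⊕ Fin (p.l + q.l)) → ((Fin p.k ⊕ Fin p.l) ⊕ (Fin q.k ⊕ Fin q.l))
  | .inl i => (finSumFinEquiv.symm i).elim (fun a => .inl (.inl a)) (fun b => .inr (.inl b))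
  | .inr j => (finSumFinEquiv.symm j).elim (fun a => .inl (.inr a)) (fun b => .inr (.inr b))

def tensor (p q : NCP) : NCP where
  k := p.k + q.k
  l := p.l + q.l
  rel := Setoid.comap (splitPt p q) (sumSetoid p.rel q.rel)

def compEmbMid (q p : NCP) (h : q.l = p.k) :
    (Fin p.k ⊕ Fin p.l) → ((Fin q.k ⊕ Fin q.l) ⊕ Fin p.l)
  | .inl i => .inl (.inr (Fin.cast h.symm i))
  | .inr j => .inr j

def compRel (q p : NCP) (h : q.l = p.k) :
    ((Fin q.k ⊕ Fin q.l) ⊕ Fin p.l) → ((Fin q.k ⊕ Fin q.l) ⊕ Fin p.l) → Prop :=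
  fun t t' =>
    (∃ x y, q.rel.r x y ∧ t = .inl x ∧ t' = .inl y) ∨
    (∃ x y, p.rel.r x y ∧ t = compEmbMid q p h x ∧ t' = compEmbMid q p h y)

def comp (q p : NCP) (h : q.l = p.k) : NCP where
  k := q.k
  l := p.l
  rel := Setoid.comap
    (Sum.elim (fun i : Fin q.k => (Sum.inl (Sum.inl i) : (Fin q.k ⊕ Fin q.l) ⊕ Fin p.l))
      (fun j : Fin p.l => Sum.inr j))
    (Relation.EqvGen.setoid (compRel q p h))

def invol (p : NCP) : NCP where
  k := p.l
  l := p.k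
  rel := Setoid.comap Sum.swap p.rel

/-- The non-colored identity partition. -/
def idN : NCP := ⟨1, 1, ⊤⟩

/-- The non-colored pair partition on two lower points. -/
def pairN : NCP := ⟨0, 2, ⊤⟩

end NCP

/-- A category of non-colored partitions. -/
structure IsCategoryN (D : Set NCP) : Prop where
  tensor_mem : ∀ p ∈ D, ∀ q ∈ D, NCP.tensor p q ∈ D
  comp_mem : ∀ q ∈ D, ∀ p ∈ D, ∀ h : q.l = p.k, NCP.comp q p h ∈ D
  invol_mem : ∀ p ∈ D, NCP.invol p ∈ D
  id_mem : NCP.idN ∈ D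
  pair_mem : NCP.pairN ∈ D

/-- The map `Ψ` forgetting the colors of a two-colored partition. -/
def forget (p : TCP) : NCP := ⟨p.k, p.l, p.rel⟩

theorem IsCategory.generated (S : Set TCP) : IsCategory (generated S) where
  tensor_mem p hp q hq D hD hS := hD.tensor_mem p (hp D hD hS) q (hq D hD hS)
  comp_mem q hq p hp h hm D hD hS := hD.comp_mem q (hq D hD hS) p (hp D hD hS) h hm
  invol_mem p hp D hD hS := hD.invol_mem p (hp D hD hS)
  idw_mem _ hD _ := hD.idw_mem
  idb_mem _ hD _ := hD.idb_mem
  pairwb_mem _ hD _ := hD.pairwb_mem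
  pairbw_mem _ hD _ := hD.pairbw_mem

theorem TCP.mk_congr {k l : ℕ} {u u' : Fin k → Color} {v v' : Fin l → Color}
    {r r' : Setoid (Fin k ⊕ Fin l)} (hu : ∀ i, u i = u' i) (hv : ∀ j, v j = v' j)
    (hr : ∀ x y, r x y ↔ r' x y) : TCP.mk k l u v r = TCP.mk k l u' v' r' := by
  obtain rfl := funext hu
  obtain rfl := funext hv
  obtain rfl := Setoid.ext hr
  rfl

/-- The partition of the permutation `σ`: the lower point `j` is connected to the upper
point `σ j`. -/
def permPart (n : ℕ) (c : Fin n → Color) (σ : Equiv.Perm (Fin n)) : TCP where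
  k := n
  l := n
  upColor := c
  lowColor := c ∘ σ
  rel := Setoid.ker (Sum.elim id σ)

/-- The partition `p` with its upper points permuted by `σ` and its lower points
permuted by `τ`. -/
def reorder (p : TCP) (σ : Equiv.Perm (Fin p.k)) (τ : Equiv.Perm (Fin p.l)) : TCP where
  k := p.k
  l := p.l
  upColor := p.upColor ∘ σ
  lowColor := p.lowColor ∘ τ
  rel := Setoid.comap (Sum.map σ τ) p.rel

/-- Composing with the partition of a permutation permutes the lower points. -/
theorem comp_permPart (p : TCP) (τ : Equiv.Perm (Fin p.l)) :
    comp p (permPart p.l p.lowColor τ) rfl = reorder p 1 τ := by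
  refine TCP.mk_congr (fun _ => rfl) (fun _ => rfl) fun x y => ?_
  let g : (Fin p.k ⊕ Fin p.l) ⊕ Fin p.l → Fin p.k ⊕ Fin p.l :=
    Sum.elim id (fun j => Sum.inr (τ j))
  have hemb : ∀ z, g (compEmbMid p (permPart p.l p.lowColor τ) rfl z)
      = Sum.inr (Sum.elim id τ z) := by
    rintro (i | j) <;> rfl
  have hg : ∀ s t, Relation.EqvGen (compRel p (permPart p.l p.lowColor τ) rfl) s t →
      p.rel (g s) (g t) := by
    intro s t h
    induction h with
    | rel s t h =>
      rcases h with ⟨x, y, hxy, rfl, rfl⟩ | ⟨x, y, hxy, rfl, rfl⟩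
      · exact hxy
      · rw [hemb, hemb, show Sum.elim id τ x = Sum.elim id τ y from hxy]
    | refl s => exact p.rel.refl _
    | symm s t _ ih => exact p.rel.symm ih
    | trans s t u _ _ ih₁ ih₂ => exact p.rel.trans ih₁ ih₂
  have hrep : ∀ s, Relation.EqvGen (compRel p (permPart p.l p.lowColor τ) rfl) s
      (Sum.inl (g s)) := by
    rintro (x | j)
    · exact .refl _
    · exact .rel _ _ (Or.inr ⟨Sum.inr j, Sum.inl (τ j), rfl, rfl, rfl⟩)
  have key : ∀ s t, Relation.EqvGen (compRel p (permPart p.l p.lowColor τ) rfl) s t ↔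
      p.rel (g s) (g t) := fun s t =>
    ⟨hg s t, fun h => (hrep s).trans _ _ _
      (.trans _ _ _ (.rel _ _ (Or.inl ⟨_, _, h, rfl, rfl⟩)) (.symm _ _ (hrep t)))⟩
  refine (key _ _).trans ?_
  rcases x with x | x <;> rcases y with y | y <;> rfl

theorem permPart_reorder (n : ℕ) (c : Fin n → Color) (σ τ : Equiv.Perm (Fin n)) :
    reorder (permPart n c σ) 1 τ = permPart n c (σ * τ) := by
  refine TCP.mk_congr (fun _ => rfl) (fun _ => rfl) fun x y => ?_
  rcases x with x | x <;> rcases y with y | y <;> rfl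

/-- The permutation acting as `σ` on the first and as `τ` on the last points. -/
def blockPerm {n m : ℕ} (σ : Equiv.Perm (Fin n)) (τ : Equiv.Perm (Fin m)) :
    Equiv.Perm (Fin (n + m)) :=
  finSumFinEquiv.permCongr (σ.sumCongr τ)

@[simp] theorem blockPerm_castAdd {n m : ℕ} (σ : Equiv.Perm (Fin n)) (τ : Equiv.Perm (Fin m))
    (i : Fin n) : blockPerm σ τ (Fin.castAdd m i) = Fin.castAdd m (σ i) := by
  simp [blockPerm, Equiv.permCongr_apply]

@[simp] theorem blockPerm_natAdd {n m : ℕ} (σ : Equiv.Perm (Fin n)) (τ : Equiv.Perm (Fin m))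
    (i : Fin m) : blockPerm σ τ (Fin.natAdd n i) = Fin.natAdd n (τ i) := by
  simp [blockPerm, Equiv.permCongr_apply]

/-- If the blocks of `p` and `q` are the fibers of labelings, then so are those of their
tensor product. -/
theorem tensor_rel_iff {p q : TCP} {α β : Type*} {f : Fin p.k ⊕ Fin p.l → α}
    {g : Fin q.k ⊕ Fin q.l → β} (hp : ∀ x y, p.rel x y ↔ f x = f y)
    (hq : ∀ x y, q.rel x y ↔ g x = g y) (x y) :
    (tensor p q).rel x y ↔ Sum.map f g (splitPt p q x) = Sum.map f g (splitPt p q y) := by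
  change sumRel _ _ (splitPt p q x) (splitPt p q y) ↔ _
  rcases splitPt p q x with a | a <;> rcases splitPt p q y with b | b
  · exact (hp a b).trans Sum.inl_injective.eq_iff.symm
  · simp [sumRel]
  · simp [sumRel]
  · exact (hq a b).trans Sum.inr_injective.eq_iff.symm

theorem tensor_permPart {n m : ℕ} (c : Fin (n + m) → Color) (σ : Equiv.Perm (Fin n))
    (τ : Equiv.Perm (Fin m)) :
    tensor (permPart n (fun i => c (Fin.castAdd m i)) σ)
      (permPart m (fun i => c (Fin.natAdd n i)) τ) = permPart (n + m) c (blockPerm σ τ) := by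
  refine TCP.mk_congr (fun i => ?_) (fun i => ?_) fun x y => ?_
  · obtain ⟨i, rfl⟩ := (finSumFinEquiv (m := n) (n := m)).surjective i
    change Sum.elim (fun i => c (Fin.castAdd m i)) (fun i => c (Fin.natAdd n i))
      (finSumFinEquiv.symm (finSumFinEquiv i)) = _
    rw [Equiv.symm_apply_apply]
    cases i <;> rfl
  · obtain ⟨i, rfl⟩ := (finSumFinEquiv (m := n) (n := m)).surjective i
    change Sum.elim (fun i => c (Fin.castAdd m (σ i))) (fun i => c (Fin.natAdd n (τ i)))
      (finSumFinEquiv.symm (finSumFinEquiv i)) = _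
    rw [Equiv.symm_apply_apply]
    cases i
    · exact congrArg c (blockPerm_castAdd σ τ _).symm
    · exact congrArg c (blockPerm_natAdd σ τ _).symm
  · have hsplit : ∀ z, Sum.map (Sum.elim id σ) (Sum.elim id τ)
        (splitPt (permPart n (fun i => c (Fin.castAdd m i)) σ)
          (permPart m (fun i => c (Fin.natAdd n i)) τ) z)
        = finSumFinEquiv.symm (Sum.elim id (blockPerm σ τ) z) := by
      rintro (i | i)
      · change Sum.map (Sum.elim id σ) (Sum.elim id τ)
          ((finSumFinEquiv.symm i).elim (fun a => .inl (.inl a)) (fun b => .inr (.inl b)))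
          = finSumFinEquiv.symm i
        cases finSumFinEquiv.symm i <;> rfl
      · change Sum.map (Sum.elim id σ) (Sum.elim id τ)
          ((finSumFinEquiv.symm i).elim (fun a => .inl (.inr a)) (fun b => .inr (.inr b)))
          = finSumFinEquiv.symm (finSumFinEquiv (Sum.map σ τ (finSumFinEquiv.symm i)))
        rw [Equiv.symm_apply_apply]
        obtain ⟨i, rfl⟩ := (finSumFinEquiv (m := n) (n := m)).surjective i
        change Sum.map (Sum.elim id σ) (Sum.elim id τ)
          (Sum.elim _ _ (finSumFinEquiv.symm (finSumFinEquiv i))) = _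
        rw [Equiv.symm_apply_apply]
        cases i <;> rfl
    refine (tensor_rel_iff (fun _ _ => Iff.rfl) (fun _ _ => Iff.rfl) x y).trans ?_
    exact (hsplit x).symm ▸ (hsplit y).symm ▸ finSumFinEquiv.symm.injective.eq_iff

theorem blockPerm_one (n m : ℕ) :
    blockPerm (1 : Equiv.Perm (Fin n)) (1 : Equiv.Perm (Fin m)) = 1 := by
  ext i
  induction i using Fin.addCases <;> simp

theorem blockPerm_swap_left {n : ℕ} (i j : Fin n) :
    blockPerm (Equiv.swap i j) (1 : Equiv.Perm (Fin 1)) = Equiv.swap i.castSucc j.castSucc := by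
  ext x
  induction x using Fin.addCases with
  | left x =>
    rw [blockPerm_castAdd]
    exact congrArg Fin.val ((Fin.castSucc_injective n).map_swap i j x)
  | right x =>
    rw [blockPerm_natAdd, Equiv.swap_apply_of_ne_of_ne] <;>
      simp [Fin.ext_iff] <;> omega

theorem blockPerm_swap_right (n : ℕ) :
    blockPerm (1 : Equiv.Perm (Fin n)) (Equiv.swap (0 : Fin 2) 1)
      = Equiv.swap (Fin.last n).castSucc (Fin.last n).succ := by
  ext x
  induction x using Fin.addCases with
  | left x =>
    rw [blockPerm_castAdd, Equiv.swap_apply_of_ne_of_ne] <;>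
      simp [Fin.ext_iff] <;> omega
  | right x =>
    rw [blockPerm_natAdd]
    exact congrArg Fin.val ((Fin.natAdd_injective 2 n).map_swap 0 1 x)

section Category

variable {E : Set TCP}

theorem IsCategory.idPart_mem (hE : IsCategory E) (c : Color) : idPart c ∈ E := by
  cases c
  · exact hE.idb_mem
  · exact hE.idw_mem

theorem IsCategory.pairLower_mem (hE : IsCategory E) (c : Color) : pairLower c (!c) ∈ E := by
  cases c
  · exact hE.pairbw_mem
  · exact hE.pairwb_mem

theorem IsCategory.pairLower_mem' (hE : IsCategory E) (c : Color) : pairLower (!c) c ∈ E := by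
  cases c
  · exact hE.pairwb_mem
  · exact hE.pairbw_mem

theorem IsCategory.permPart_one_mem (hE : IsCategory E) :
    ∀ (n : ℕ) (c : Fin n → Color), permPart n c 1 ∈ E
  | 0, c => by
    have h := hE.comp_mem _ hE.pairwb_mem _ (hE.invol_mem _ hE.pairwb_mem) rfl (fun _ => rfl)
    convert h using 1
    exact TCP.mk_congr (fun i => i.elim0) (fun i => i.elim0)
      (fun x => x.elim (fun i => i.elim0) (fun i => i.elim0))
  | n + 1, c => by
    rw [← blockPerm_one n 1, ← tensor_permPart]
    refine hE.tensor_mem _ (permPart_one_mem hE n _) _ ?_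
    convert hE.idPart_mem (c (Fin.natAdd n 0)) using 1
    refine TCP.mk_congr (fun i => ?_) (fun i => ?_) fun x y => ?_
    · rw [Subsingleton.elim i 0]
    · rw [Subsingleton.elim i 0]; rfl
    · exact ⟨fun _ => trivial, fun _ => Subsingleton.elim (α := Fin 1) _ _⟩

theorem IsCategory.permPart_mul_mem (hE : IsCategory E) {n : ℕ} {σ τ : Equiv.Perm (Fin n)}
    (hσ : ∀ c, permPart n c σ ∈ E) (hτ : ∀ c, permPart n c τ ∈ E) (c : Fin n → Color) :
    permPart n c (σ * τ) ∈ E := by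
  have h := hE.comp_mem _ (hσ c) _ (hτ (c ∘ σ)) rfl fun _ => rfl
  exact ((comp_permPart (permPart n c σ) τ).trans (permPart_reorder n c σ τ)) ▸ h

/-- The partition whose blocks are the fibers of the labeling `Sum.elim f g`. -/
def labelPart {k l : ℕ} (u : Fin k → Color) (v : Fin l → Color) (f : Fin k → ℕ)
    (g : Fin l → ℕ) : TCP where
  k := k
  l := l
  upColor := u
  lowColor := v
  rel := Setoid.ker (Sum.elim f g)

theorem idPart_rel_iff (c : Color) (x y) :
    (idPart c).rel x y ↔ (fun _ => ()) x = (fun _ => ()) y :=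
  ⟨fun _ => rfl, fun _ => trivial⟩

theorem pairLower_rel_iff (c d : Color) (x y) :
    (pairLower c d).rel x y ↔ (fun _ => ()) x = (fun _ => ()) y := by
  rcases x with x | x
  · exact x.elim0
  rcases y with y | y
  · exact y.elim0
  exact ⟨fun _ => rfl, fun _ => rfl⟩

theorem invol_pairLower_rel_iff (c d : Color) (x y) :
    (invol (pairLower c d)).rel x y ↔ (fun _ => ()) x = (fun _ => ()) y :=
  pairLower_rel_iff c d _ _

theorem tensor_id_id_pair (a b c d : Color) :
    tensor (tensor (idPart a) (idPart b)) (pairLower c d)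
      = labelPart ![a, b] ![a, b, c, d] ![0, 1] ![0, 1, 2, 2] := by
  refine TCP.mk_congr (fun (i : Fin 2) => ?_) (fun (j : Fin 4) => ?_)
    (fun (x : Fin 2 ⊕ Fin 4) (y : Fin 2 ⊕ Fin 4) => ?_)
  · revert a b c d i
    decide
  · revert a b c d j
    decide
  · refine (tensor_rel_iff (tensor_rel_iff (idPart_rel_iff a) (idPart_rel_iff b))
      (pairLower_rel_iff c d) x y).trans ?_
    change _ ↔ Sum.elim _ _ x = Sum.elim _ _ y
    revert a b c d x y
    decide

theorem tensor_copair_id_id (a b c d : Color) :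
    tensor (tensor (invol (pairLower a b)) (idPart c)) (idPart d)
      = labelPart ![a, b, c, d] ![c, d] ![0, 0, 1, 2] ![1, 2] := by
  refine TCP.mk_congr (fun (i : Fin 4) => ?_) (fun (j : Fin 2) => ?_)
    (fun (x : Fin 4 ⊕ Fin 2) (y : Fin 4 ⊕ Fin 2) => ?_)
  · revert a b c d i
    decide
  · revert a b c d j
    decide
  · refine (tensor_rel_iff (tensor_rel_iff (invol_pairLower_rel_iff a b) (idPart_rel_iff c))
      (idPart_rel_iff d) x y).trans ?_
    change _ ↔ Sum.elim _ _ x = Sum.elim _ _ y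
    revert a b c d x y
    decide

theorem tensor_id_cross_id (a b c d : Color) :
    tensor (tensor (idPart a) (permPart 2 ![b, c] (Equiv.swap 0 1))) (idPart d)
      = permPart 4 ![a, b, c, d] (Equiv.swap 1 2) := by
  refine TCP.mk_congr (fun (i : Fin 4) => ?_) (fun (j : Fin 4) => ?_)
    (fun (x : Fin 4 ⊕ Fin 4) (y : Fin 4 ⊕ Fin 4) => ?_)
  · revert a b c d i
    decide
  · revert a b c d j
    decide
  · refine (tensor_rel_iff (tensor_rel_iff (idPart_rel_iff a)
      (q := permPart 2 ![b, c] (Equiv.swap 0 1)) (fun _ _ => Iff.rfl))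
      (idPart_rel_iff d) x y).trans ?_
    change _ ↔ Sum.elim id (Equiv.swap (1 : Fin 4) 2) x = Sum.elim id (Equiv.swap (1 : Fin 4) 2) y
    revert a b c d x y
    decide

theorem reorder_id_id_pair (a b c d : Color) :
    reorder (labelPart ![a, b] ![a, b, c, d] ![0, 1] ![0, 1, 2, 2]) 1
        (Equiv.swap 1 2 : Equiv.Perm (Fin 4))
      = labelPart ![a, b] ![a, c, b, d] ![0, 1] ![0, 2, 1, 2] := by
  refine TCP.mk_congr (fun _ => rfl) (fun (j : Fin 4) => ?_)
    (fun (x : Fin 2 ⊕ Fin 4) (y : Fin 2 ⊕ Fin 4) => ?_)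
  · change ![a, b, c, d] (Equiv.swap 1 2 j) = ![a, c, b, d] j
    revert a b c d j
    decide
  · change Sum.elim _ _ (Sum.map (1 : Equiv.Perm (Fin 2)) (Equiv.swap (1 : Fin 4) 2) x)
      = Sum.elim _ _ (Sum.map (1 : Equiv.Perm (Fin 2)) (Equiv.swap (1 : Fin 4) 2) y) ↔
      Sum.elim _ _ x = Sum.elim _ _ y
    clear * -
    revert x y
    decide

theorem comp_zigzag (a b c d : Color) (v : Fin 4 → Color) :
    comp (labelPart ![a, b] v ![0, 1] ![0, 2, 1, 2]) (labelPart v ![c, d] ![0, 0, 1, 2] ![1, 2]) rfl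
      = labelPart ![a, b] ![c, d] ![0, 1] ![1, 0] := by
  refine TCP.mk_congr (fun _ => rfl) (fun _ => rfl)
    (fun (x : Fin 2 ⊕ Fin 2) (y : Fin 2 ⊕ Fin 2) => ?_)
  set R := compRel (labelPart ![a, b] v ![0, 1] ![0, 2, 1, 2])
    (labelPart v ![c, d] ![0, 0, 1, 2] ![1, 2]) rfl
  let g : (Fin 2 ⊕ Fin 4) ⊕ Fin 2 → Fin 2 :=
    Sum.elim (Sum.elim ![0, 1] ![0, 0, 1, 0]) ![1, 0]
  have hq : ∀ x y : Fin 2 ⊕ Fin 4,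
      Sum.elim ![0, 1] ![0, 2, 1, 2] x = (Sum.elim ![0, 1] ![0, 2, 1, 2] y : ℕ) →
      g (.inl x) = g (.inl y) := by
    simp only [g]
    clear * -
    decide
  have hp : ∀ x y : Fin 4 ⊕ Fin 2,
      Sum.elim ![0, 0, 1, 2] ![1, 2] x = (Sum.elim ![0, 0, 1, 2] ![1, 2] y : ℕ) →
      g (Sum.elim (fun i => .inl (.inr i)) .inr x)
        = g (Sum.elim (fun i => .inl (.inr i)) .inr y) := by
    simp only [g]
    clear * -
    decide
  have hstep : ∀ s t, R s t → g s = g t := by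
    rintro s t (⟨x, y, hxy, rfl, rfl⟩ | ⟨x, y, hxy, rfl, rfl⟩)
    · exact hq x y hxy
    · have := hp x y hxy
      rcases x with x | x <;> rcases y with y | y <;> exact this
  have hg : ∀ s t, Relation.EqvGen R s t → g s = g t := by
    intro s t h
    induction h with
    | rel s t h => exact hstep s t h
    | refl s => rfl
    | symm s t _ ih => exact ih.symm
    | trans s t u _ _ ih₁ ih₂ => exact ih₁.trans ih₂
  have upper : ∀ x y : Fin 2 ⊕ Fin 4,
      Sum.elim ![0, 1] ![0, 2, 1, 2] x = (Sum.elim ![0, 1] ![0, 2, 1, 2] y : ℕ) →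
      Relation.EqvGen R (.inl x) (.inl y) := fun x y h =>
    .rel _ _ (Or.inl ⟨x, y, h, rfl, rfl⟩)
  have m0 : Relation.EqvGen R (.inl (.inr (0 : Fin 4))) (.inl (.inl (0 : Fin 2))) :=
    upper _ _ rfl
  have m2 : Relation.EqvGen R (.inl (.inr (2 : Fin 4))) (.inl (.inl (1 : Fin 2))) :=
    upper _ _ rfl
  have m1 : Relation.EqvGen R (.inl (.inr (1 : Fin 4))) (.inl (.inl (0 : Fin 2))) :=
    .trans _ _ _ (.rel _ _ (Or.inr ⟨.inl (1 : Fin 4), .inl (0 : Fin 4), rfl, rfl, rfl⟩)) m0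
  have m3 : Relation.EqvGen R (.inl (.inr (3 : Fin 4))) (.inl (.inl (0 : Fin 2))) :=
    .trans _ _ _ (upper _ (.inr 1) rfl) m1
  have l0 : Relation.EqvGen R (.inr (0 : Fin 2)) (.inl (.inl (1 : Fin 2))) :=
    .trans _ _ _ (.rel _ _ (Or.inr ⟨.inr (0 : Fin 2), .inl (2 : Fin 4), rfl, rfl, rfl⟩)) m2
  have l1 : Relation.EqvGen R (.inr (1 : Fin 2)) (.inl (.inl (0 : Fin 2))) :=
    .trans _ _ _ (.rel _ _ (Or.inr ⟨.inr (1 : Fin 2), .inl (3 : Fin 4), rfl, rfl, rfl⟩)) m3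
  let e : Fin 2 ⊕ Fin 2 → (Fin 2 ⊕ Fin 4) ⊕ Fin 2 := Sum.elim (fun i => .inl (.inl i)) .inr
  have hrep : ∀ z : Fin 2 ⊕ Fin 2, Relation.EqvGen R (e z) (.inl (.inl (g (e z)))) := by
    rintro (i | i) <;> fin_cases i
    · exact .refl _
    · exact .refl _
    · exact l0
    · exact l1
  have hge : g (e x) = g (e y) ↔
      Sum.elim ![0, 1] ![1, 0] x = (Sum.elim ![0, 1] ![1, 0] y : ℕ) := by
    clear * -
    revert x y
    decide
  refine Iff.trans ⟨fun h => hg (e x) (e y) h, fun h => ?_⟩ hge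
  exact .trans _ _ _ (hrep x) (h ▸ .symm _ _ (hrep y))

theorem labelPart_eq_permPart_swap (a b : Color) :
    labelPart ![a, b] ![b, a] ![0, 1] ![1, 0] = permPart 2 ![a, b] (Equiv.swap 0 1) := by
  refine TCP.mk_congr (fun _ => rfl) (fun j => ?_) fun x y => ?_
  · revert a b j
    decide
  · change Sum.elim _ _ x = Sum.elim _ _ y ↔
      Sum.elim id (Equiv.swap (0 : Fin 2) 1) x = Sum.elim id (Equiv.swap (0 : Fin 2) 1) y
    clear * -
    revert x y
    decide

theorem IsCategory.reorder_lower_mem_of (hE : IsCategory E) {p : TCP} (hp : p ∈ E)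
    {τ : Equiv.Perm (Fin p.l)} (hτ : permPart p.l p.lowColor τ ∈ E) : reorder p 1 τ ∈ E :=
  comp_permPart p τ ▸ hE.comp_mem p hp _ hτ rfl fun _ => rfl

/-- Rotating a crossing of two strings. -/
theorem IsCategory.rotate_cross_mem (hE : IsCategory E) (c d : Color)
    (h : permPart 2 ![d, c] (Equiv.swap 0 1) ∈ E) :
    permPart 2 ![!c, d] (Equiv.swap 0 1) ∈ E := by
  have hA := hE.tensor_mem _ (hE.tensor_mem _ (hE.idPart_mem (!c)) _ (hE.idPart_mem d)) _
    (hE.pairLower_mem c)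
  have hB := hE.tensor_mem _ (hE.tensor_mem _ (hE.idPart_mem (!c)) _ h) _ (hE.idPart_mem (!c))
  have hD := hE.tensor_mem _ (hE.tensor_mem _
    (hE.invol_mem _ (hE.pairLower_mem' c)) _ (hE.idPart_mem d)) _ (hE.idPart_mem (!c))
  rw [tensor_id_id_pair] at hA
  rw [tensor_id_cross_id] at hB
  rw [tensor_copair_id_id] at hD
  have hAB := hE.reorder_lower_mem_of hA hB
  have hAB' : labelPart ![!c, d] ![!c, c, d, !c] ![0, 1] ![0, 2, 1, 2] ∈ E :=
    reorder_id_id_pair (!c) d c (!c) ▸ hAB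
  have hABD := hE.comp_mem _ hAB' _ hD rfl fun _ => rfl
  rw [comp_zigzag, labelPart_eq_permPart_swap] at hABD
  exact hABD

theorem crossPart_eq : crossPart = permPart 2 ![white, white] (Equiv.swap 0 1) := by
  refine TCP.mk_congr (fun j => ?_) (fun j => ?_) fun x y => ?_
  · revert j
    decide
  · revert j
    decide
  · change Sum.elim _ _ x = Sum.elim _ _ y ↔
      Sum.elim id (Equiv.swap (0 : Fin 2) 1) x = Sum.elim id (Equiv.swap (0 : Fin 2) 1) y
    revert x y
    decide

theorem IsCategory.cross_mem (hE : IsCategory E) (hX : crossPart ∈ E) (c : Fin 2 → Color) :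
    permPart 2 c (Equiv.swap 0 1) ∈ E := by
  rw [crossPart_eq] at hX
  have h₁ := hE.rotate_cross_mem _ _ hX
  have h₂ := hE.rotate_cross_mem _ _ h₁
  have h₃ := hE.rotate_cross_mem _ _ h₂
  have hc : c = ![c 0, c 1] := by
    ext i
    fin_cases i <;> rfl
  rw [hc]
  cases c 0 <;> cases c 1 <;> assumption

theorem IsCategory.permPart_swap_mem (hE : IsCategory E) (hX : crossPart ∈ E) :
    ∀ (n : ℕ) (i : Fin n) (c : Fin (n + 1) → Color),
      permPart (n + 1) c (Equiv.swap i.castSucc i.succ) ∈ E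
  | n + 1, i, c => by
    induction i using Fin.lastCases with
    | last =>
      rw [← blockPerm_swap_right]
      exact tensor_permPart (m := 2) c 1 _ ▸
        hE.tensor_mem _ (hE.permPart_one_mem n _) _ (hE.cross_mem hX _)
    | cast i =>
      rw [Fin.succ_castSucc, ← blockPerm_swap_left]
      exact tensor_permPart (m := 1) c _ 1 ▸
        hE.tensor_mem _ (permPart_swap_mem hE hX n i _) _ (hE.permPart_one_mem 1 _)

theorem IsCategory.permPart_mem (hE : IsCategory E) (hX : crossPart ∈ E) :
    ∀ (n : ℕ) (σ : Equiv.Perm (Fin n)) (c : Fin n → Color), permPart n c σ ∈ E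
  | 0, σ, c => Subsingleton.elim 1 σ ▸ hE.permPart_one_mem 0 c
  | n + 1, σ, c => by
    have hσ : σ ∈ Submonoid.closure
        (Set.range fun i : Fin n => Equiv.swap i.castSucc i.succ) := by
      rw [Equiv.Perm.mclosure_swap_castSucc_succ]
      trivial
    induction hσ using Submonoid.closure_induction generalizing c with
    | mem σ h =>
      obtain ⟨i, rfl⟩ := h
      exact hE.permPart_swap_mem hX n i c
    | one => exact hE.permPart_one_mem _ c
    | mul σ τ _ _ hσ hτ => exact hE.permPart_mul_mem hσ hτ c

theorem IsCategory.reorder_mem (hE : IsCategory E) (hX : crossPart ∈ E) {p : TCP} (hp : p ∈ E)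
    (σ : Equiv.Perm (Fin p.k)) (τ : Equiv.Perm (Fin p.l)) : reorder p σ τ ∈ E := by
  have h₁ := hE.reorder_lower_mem_of (hE.invol_mem _ hp)
    (hE.permPart_mem hX _ σ (invol p).lowColor)
  have h₂ := hE.reorder_lower_mem_of (hE.invol_mem _ h₁) (hE.permPart_mem hX _ τ _)
  convert h₂ using 1
  refine TCP.mk_congr (fun _ => rfl) (fun _ => rfl) fun x y => ?_
  rcases x with x | x <;> rcases y with y | y <;> rfl

end Category

theorem reorder_reorder_symm (p : TCP) (σ : Equiv.Perm (Fin p.k)) (τ : Equiv.Perm (Fin p.l)) :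
    reorder (reorder p σ τ) σ.symm τ.symm = p := by
  obtain ⟨k, l, u, v, r⟩ := p
  refine TCP.mk_congr (fun i => congrArg u (σ.apply_symm_apply i))
    (fun j => congrArg v (τ.apply_symm_apply j)) fun x y => ?_
  have h : ∀ z : Fin k ⊕ Fin l, Sum.map σ τ (Sum.map σ.symm τ.symm z) = z := by
    rintro (z | z)
    · exact congrArg Sum.inl (σ.apply_symm_apply z)
    · exact congrArg Sum.inr (τ.apply_symm_apply z)
  exact iff_of_eq (congrArg₂ r (h x) (h y))

/-- A partition whose blocks are labeled increasingly along both rows is noncrossing: along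
the line the labels first decrease and then increase. -/
theorem noncrossing_of_monotone {p : TCP} (f : Fin p.k ⊕ Fin p.l → ℕ)
    (hf : ∀ x y, p.rel x y ↔ f x = f y) (hu : Monotone (f ∘ Sum.inl))
    (hl : Monotone (f ∘ Sum.inr)) : Noncrossing p := by
  have valley : ∀ a b c, linePos p a < linePos p b → linePos p b < linePos p c →
      f b ≤ max (f a) (f c) := by
    rintro a (b | b) c hab hbc
    · refine le_max_of_le_left ?_
      rcases a with a | a
      · exact hu (Fin.le_def.2 (by simp only [linePos, Sum.elim_inl] at hab; omega))
      · simp only [linePos, Sum.elim_inl, Sum.elim_inr] at hab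
        omega
    · refine le_max_of_le_right ?_
      rcases c with c | c
      · simp only [linePos, Sum.elim_inl, Sum.elim_inr] at hbc
        omega
      · exact hl (Fin.le_def.2 (by simp only [linePos, Sum.elim_inr] at hbc; omega))
  intro a b x y hab hbx hxy hax hby
  have h₁ := valley a b x hab hbx
  have h₂ := valley b x y hbx hxy
  have hax := (hf a x).1 hax
  have hby := (hf b y).1 hby
  refine (hf a b).2 ?_
  rw [← hax, max_self] at h₁
  rw [← hby, max_self] at h₂
  omega

/-- Every partition becomes noncrossing after permuting its rows. -/
theorem exists_reorder_noncrossing (p : TCP) : ∃ σ τ, Noncrossing (reorder p σ τ) := by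
  obtain ⟨n, ⟨e⟩⟩ := Finite.exists_equiv_fin (Quotient p.rel)
  let f : Fin p.k ⊕ Fin p.l → ℕ := fun x => e (Quotient.mk p.rel x)
  have hf : ∀ x y, p.rel x y ↔ f x = f y := fun x y =>
    Quotient.eq.symm.trans (e.injective.eq_iff.symm.trans Fin.val_injective.eq_iff.symm)
  let σ := Tuple.sort (f ∘ Sum.inl)
  let τ := Tuple.sort (f ∘ Sum.inr)
  exact ⟨σ, τ, noncrossing_of_monotone (p := reorder p σ τ) (f ∘ Sum.map σ τ)
    (fun _ _ => hf _ _) (Tuple.monotone_sort (f ∘ Sum.inl)) (Tuple.monotone_sort (f ∘ Sum.inr))⟩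

/-- In the group case, `C` is generated by its noncrossing part together with the
crossing partition. -/
theorem stmt_18 (C : Set TCP) (hC : IsCategory C) (hX : crossPart ∈ C) :
    C = generated ({p ∈ C | Noncrossing p} ∪ {crossPart}) := by
  refine Set.Subset.antisymm (fun p hp => ?_) fun p hp => hp C hC ?_
  · have hD := IsCategory.generated ({p ∈ C | Noncrossing p} ∪ {crossPart})
    have hXD : crossPart ∈ generated ({p ∈ C | Noncrossing p} ∪ {crossPart}) :=
      fun _ _ h => h (Or.inr rfl)
    obtain ⟨σ, τ, hnc⟩ := exists_reorder_noncrossing p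
    have hq : reorder p σ τ ∈ generated ({p ∈ C | Noncrossing p} ∪ {crossPart}) :=
      fun _ _ h => h (Or.inl ⟨hC.reorder_mem hX hp σ τ, hnc⟩)
    exact reorder_reorder_symm p σ τ ▸ hD.reorder_mem hXD hq σ.symm τ.symm
  · rintro q (hq | rfl)
    · exact hq.1
    · exact hX


end CTCP
end
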